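/- arXiv:2103.07496 — 5 statements merged into one kernel-verified Lean document; each statement's English description precedes it below -/
import Mathlib

section
/- Let f : ℝ → ℝ be a smooth, even, compactly supported function. Then |I_{F_f} − 2∫₀^∞ f(x)·cosh(x/2) dx| ≤ 4·∫_ℝ |f(x)| dx. (Here 2∫₀^∞ f(x)·cosh(x/2) dx equals the value f̂(i/2) of the Fourier transform f̂(r) = ∫_ℝ f(x)e^{−irx} dx at r = i/2.) -/
open MeasureTheory Real

theorem natCast_mul_sinh_sq_le_sinh_natCast_mul {t : ℝ} (ht : 0 ≤ t) (k : ℕ) :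
    ((k : ℝ) + 2) * sinh t ^ 2 ≤ sinh (((k : ℝ) + 2) * t) := by
  have hs : 0 ≤ sinh t := sinh_nonneg_iff.2 ht
  have hc : sinh t ≤ cosh t := (sinh_lt_cosh t).le
  induction k with
  | zero =>
    simp only [Nat.cast_zero, zero_add, sinh_two_mul]
    nlinarith
  | succ k ih =>
    have hexp : (((k + 1 : ℕ) : ℝ) + 2) * t = ((k : ℝ) + 2) * t + t := by push_cast; ring
    have hkt : 0 ≤ ((k : ℝ) + 2) * t := by positivity
    have h1 : cosh t ≤ cosh (((k : ℝ) + 2) * t) := by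
      rw [cosh_le_cosh, abs_of_nonneg ht, abs_of_nonneg hkt]
      nlinarith [(Nat.cast_nonneg k : (0 : ℝ) ≤ k)]
    have h2 : 0 ≤ sinh (((k : ℝ) + 2) * t) := sinh_nonneg_iff.2 hkt
    rw [hexp, sinh_add]
    push_cast
    nlinarith [mul_le_mul_of_nonneg_left (one_le_cosh t) h2,
      mul_le_mul_of_nonneg_right (hc.trans h1) hs]

theorem hasSum_one_div_nat_add_two_sq :
    HasSum (fun k : ℕ => 1 / ((k : ℝ) + 2) ^ 2) (π ^ 2 / 6 - 1) := by
  have h := (hasSum_nat_add_iff' 2).2 hasSum_zeta_two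
  simpa [Finset.sum_range_succ] using h

theorem abs_sinh_sq_mul_div_sinh_le {l : ℝ} (hl : 0 < l) (k : ℕ) (y : ℝ) :
    |2 * sinh (l / 2) ^ 2 * (y / sinh (((k : ℝ) + 2) * l / 2))| ≤ 2 / ((k : ℝ) + 2) * |y| := by
  have hk : (0 : ℝ) < (k : ℝ) + 2 := by positivity
  have hpos : 0 < sinh (((k : ℝ) + 2) * l / 2) := sinh_pos_iff.2 (by positivity)
  have h := natCast_mul_sinh_sq_le_sinh_natCast_mul (half_pos hl).le k
  rw [← mul_div_assoc] at h
  rw [abs_mul, abs_div, abs_of_pos hpos, abs_of_nonneg (by positivity),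
    div_mul_eq_mul_div, ← mul_div_assoc, div_le_div_iff₀ hpos hk]
  nlinarith [mul_le_mul_of_nonneg_left h (abs_nonneg y)]

theorem stmt_0 (f : ℝ → ℝ) (hf : ContDiff ℝ (⊤ : ℕ∞) f) (heven : ∀ x, f (-x) = f x)
    (hsupp : HasCompactSupport f) :
    |(∫ ℓ in Set.Ioi (0:ℝ),
        (ℓ * ∑' k : ℕ, f (((k:ℝ) + 1) * ℓ) / (2 * Real.sinh (((k:ℝ) + 1) * ℓ / 2)))
          * ℓ * (Real.sinh (ℓ / 2))^2 / (ℓ / 2)^2)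
      - 2 * ∫ x in Set.Ioi (0:ℝ), f x * Real.cosh (x / 2)|
      ≤ 4 * ∫ x : ℝ, |f x| := by
  have hc : Continuous f := hf.continuous
  have hint : Integrable f := hc.integrable_of_hasCompactSupport hsupp
  have hintS : Integrable (fun x => f x * sinh (x / 2)) :=
    (hc.mul (by fun_prop)).integrable_of_hasCompactSupport hsupp.mul_right
  have hintC : Integrable (fun x => f x * cosh (x / 2)) :=
    (hc.mul (by fun_prop)).integrable_of_hasCompactSupport hsupp.mul_right
  set μ : Measure ℝ := volume.restrict (Set.Ioi (0 : ℝ)) with hμ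
  set A : ℝ := ∫ x, |f x| ∂μ with hA
  have hA0 : 0 ≤ A := integral_nonneg fun x => abs_nonneg _
  have hAle : A ≤ ∫ x : ℝ, |f x| :=
    setIntegral_le_integral hint.abs (Filter.Eventually.of_forall fun x => abs_nonneg _)
  let g : ℕ → ℝ → ℝ := fun k l =>
    2 * sinh (l / 2) ^ 2 * (f (((k : ℝ) + 2) * l) / sinh (((k : ℝ) + 2) * l / 2))
  have hdom (k : ℕ) : Integrable (fun l => 2 / ((k : ℝ) + 2) * |f (((k : ℝ) + 2) * l)|) μ :=
    (((hint.comp_mul_left' (by positivity : (k : ℝ) + 2 ≠ 0)).abs).const_mul _).integrableOn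
  have hdomI (k : ℕ) : ∫ l, 2 / ((k : ℝ) + 2) * |f (((k : ℝ) + 2) * l)| ∂μ
      = 1 / ((k : ℝ) + 2) ^ 2 * (2 * A) := by
    have hk : (0 : ℝ) < (k : ℝ) + 2 := by positivity
    rw [integral_const_mul, hμ, integral_comp_mul_left_Ioi (fun x => |f x|) 0 hk, mul_zero,
      smul_eq_mul, ← hμ, ← hA]
    field_simp
  have hgle (k : ℕ) : ∀ᵐ l ∂μ, ‖g k l‖ ≤ 2 / ((k : ℝ) + 2) * |f (((k : ℝ) + 2) * l)| :=
    (ae_restrict_mem measurableSet_Ioi).mono fun l hl => abs_sinh_sq_mul_div_sinh_le hl k _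
  have hgm (k : ℕ) : AEStronglyMeasurable (g k) μ := by
    have := hc.measurable
    have h2 : Measurable (g k) := by fun_prop
    exact h2.aestronglyMeasurable
  have hgint (k : ℕ) : Integrable (g k) μ := (hdom k).mono' (hgm k) (hgle k)
  have hgI (k : ℕ) : ∫ l, ‖g k l‖ ∂μ ≤ 1 / ((k : ℝ) + 2) ^ 2 * (2 * A) :=
    (integral_mono_ae (hgint k).norm (hdom k) (hgle k)).trans_eq (hdomI k)
  have hsum := hasSum_one_div_nat_add_two_sq.mul_right (2 * A)
  have hgs : Summable fun k => ∫ l, ‖g k l‖ ∂μ :=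
    hsum.summable.of_nonneg_of_le (fun k => integral_nonneg fun l => norm_nonneg _) hgI
  let h : ℕ → ℝ → ℝ := fun k l =>
    2 * sinh (l / 2) ^ 2 * (f (((k : ℝ) + 1) * l) / sinh (((k : ℝ) + 1) * l / 2))
  have hsucc (k : ℕ) : h (k + 1) = g k := by
    have hk : ((k + 1 : ℕ) + 1 : ℝ) = (k : ℝ) + 2 := by push_cast; ring
    simp only [h, g, hk]
  have hzero : ∀ l ∈ Set.Ioi (0 : ℝ), 2 * (f l * sinh (l / 2)) = h 0 l := by
    intro l hl
    have hs : 0 < sinh (l / 2) := sinh_pos_iff.2 (half_pos hl)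
    simp only [h, Nat.cast_zero, zero_add, one_mul]
    field_simp
  have hhint (k : ℕ) : Integrable (h k) μ := by
    cases k with
    | zero =>
      exact (hintS.const_mul 2).integrableOn.congr_fun hzero measurableSet_Ioi
    | succ k => rw [hsucc]; exact hgint k
  have hhs : Summable fun k => ∫ l, ‖h k l‖ ∂μ := by
    rw [← summable_nat_add_iff 1]
    simpa only [hsucc] using hgs
  have hI : ∫ l, (l * ∑' k : ℕ, f (((k:ℝ) + 1) * l) / (2 * Real.sinh (((k:ℝ) + 1) * l / 2)))
          * l * (Real.sinh (l / 2))^2 / (l / 2)^2 ∂μ = ∑' k, ∫ l, h k l ∂μ := by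
    rw [integral_tsum_of_summable_integral_norm hhint hhs]
    refine setIntegral_congr_fun measurableSet_Ioi fun l hl => ?_
    have hl : 0 < l := hl
    have htl : ∑' k, h k l = 4 * sinh (l / 2) ^ 2 * ∑' k : ℕ,
        f (((k : ℝ) + 1) * l) / (2 * sinh (((k : ℝ) + 1) * l / 2)) := by
      rw [← tsum_mul_left]
      refine tsum_congr fun k => ?_
      have : 0 < sinh (((k : ℝ) + 1) * l / 2) := sinh_pos_iff.2 (by positivity)
      simp only [h]
      field_simp
      ring
    simp only [htl]
    field_simp
    ring
  have htail : |∑' k, ∫ l, g k l ∂μ| ≤ 2 * A := by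
    rw [← norm_eq_abs]
    refine (tsum_of_norm_bounded hsum fun k =>
      (norm_integral_le_integral_norm _).trans (hgI k)).trans ?_
    have : π ^ 2 / 6 - 1 ≤ 1 := by nlinarith [pi_lt_d2, pi_pos]
    nlinarith
  have hhead : |∫ l, h 0 l ∂μ - 2 * ∫ l, f l * cosh (l / 2) ∂μ| ≤ 2 * A := by
    rw [← setIntegral_congr_fun measurableSet_Ioi hzero, integral_const_mul, ← mul_sub,
      ← integral_sub hintS.integrableOn hintC.integrableOn, abs_mul, abs_two]
    refine mul_le_mul_of_nonneg_left ?_ zero_le_two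
    rw [← norm_eq_abs]
    refine norm_integral_le_of_norm_le hint.abs.integrableOn ?_
    refine (ae_restrict_mem measurableSet_Ioi).mono fun l hl => ?_
    have hl : 0 < l := hl
    have he : f l * sinh (l / 2) - f l * cosh (l / 2) = -(f l * exp (-(l / 2))) := by
      rw [← cosh_sub_sinh]; ring
    rw [he, norm_neg, norm_mul, norm_eq_abs, norm_eq_abs, abs_exp]
    exact mul_le_of_le_one_right (abs_nonneg _) (exp_le_one_iff.2 (by linarith))
  have hS : Summable fun k => ∫ l, h k l ∂μ :=
    (hasSum_integral_of_summable_integral_norm hhint hhs).summable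
  rw [hI, hS.tsum_eq_zero_add, add_sub_right_comm]
  simp only [hsucc]
  exact (abs_add_le _ _).trans (by linarith)
end

section
/- For every integer k ≥ 2 and every real ℓ > 0, one has sinh(ℓ/2)² / sinh(kℓ/2) ≤ 1/k. -/
theorem Real.nat_mul_sinh_sq_le_sinh_nat_mul {x : ℝ} (hx : 0 ≤ x) {k : ℕ} (hk : 2 ≤ k) :
    (k : ℝ) * Real.sinh x ^ 2 ≤ Real.sinh (k * x) := by
  have hs : 0 ≤ Real.sinh x := Real.sinh_nonneg_iff.2 hx
  induction k, hk using Nat.le_induction with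
  | base =>
    rw [Nat.cast_ofNat, Real.sinh_two_mul]
    nlinarith [mul_le_mul_of_nonneg_left (Real.sinh_lt_cosh x).le hs]
  | succ n hn ih =>
    have hxn : x ≤ n * x := le_mul_of_one_le_left hx (by exact_mod_cast (by omega : 1 ≤ n))
    have hsc : Real.sinh x ≤ Real.cosh (n * x) :=
      (Real.sinh_le_sinh.2 hxn).trans (Real.sinh_lt_cosh _).le
    have hsn : Real.sinh (n * x) ≤ Real.sinh (n * x) * Real.cosh x :=
      le_mul_of_one_le_right (Real.sinh_nonneg_iff.2 (by positivity)) (Real.one_le_cosh x)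
    push_cast
    rw [add_mul (n : ℝ) 1 x, one_mul, Real.sinh_add]
    nlinarith [mul_le_mul_of_nonneg_right hsc hs]

/-- For every integer `k ≥ 2` and real `ℓ > 0`,
`sinh(ℓ/2)² / sinh(kℓ/2) ≤ 1/k`. -/
theorem stmt_1 (k : ℕ) (hk : 2 ≤ k) (ℓ : ℝ) (hℓ : 0 < ℓ) :
    (Real.sinh (ℓ / 2))^2 / Real.sinh ((k : ℝ) * ℓ / 2) ≤ 1 / (k : ℝ) := by
  have hk0 : (0 : ℝ) < k := by exact_mod_cast (by omega : 0 < k)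
  have h := Real.nat_mul_sinh_sq_le_sinh_nat_mul (half_pos hℓ).le hk
  rw [← mul_div_assoc] at h
  rw [div_le_div_iff₀ (Real.sinh_pos_iff.2 (by positivity)) hk0]
  linarith
end

section
/- Let γ be an isometry of the hyperbolic plane ℍ (the upper half-plane with its hyperbolic metric), and let T > 0 be such that dist(x, γ(x)) ≥ T for every x ∈ ℍ. Then for any two points p, q ∈ ℍ and any ℓ ≥ 0, the set {n ∈ ℤ : dist(p, γⁿ(q)) ≤ ℓ} has at most 2 + 2ℓ/T elements. -/
open UpperHalfPlane

/-- The midpoint `m` of `x` and `y` in the hyperbolic plane, characterized by the median identity. -/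
theorem UpperHalfPlane.exists_median (x y : UpperHalfPlane) :
    ∃ (m : UpperHalfPlane) (s : ℝ), 0 < s ∧ s ^ 2 = 2 * Real.cosh (dist x y) + 2 ∧
      ∀ w : UpperHalfPlane,
        s * Real.cosh (dist w m) = Real.cosh (dist w x) + Real.cosh (dist w y) := by
  have hx := x.im_pos
  have hy := y.im_pos
  have hc : 0 < 2 * Real.cosh (dist x y) + 2 := by positivity
  obtain ⟨s, hs0, hs2⟩ : ∃ s : ℝ, 0 < s ∧ s ^ 2 = 2 * Real.cosh (dist x y) + 2 :=
    ⟨_, Real.sqrt_pos.2 hc, Real.sq_sqrt hc.le⟩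
  refine ⟨⟨⟨(x.re * y.im + y.re * x.im) / (x.im + y.im), s * (x.im * y.im) / (x.im + y.im)⟩,
    by positivity⟩, s, hs0, hs2, fun w => ?_⟩
  have hw := w.im_pos
  rw [cosh_dist'] at hs2
  rw [cosh_dist', cosh_dist', cosh_dist']
  simp only [mk_re, mk_im]
  have key : (s * (x.im * y.im) / (x.im + y.im)) ^ 2 =
      (2 * (((x.re - y.re) ^ 2 + x.im ^ 2 + y.im ^ 2) / (2 * x.im * y.im)) + 2) *
        (x.im * y.im / (x.im + y.im)) ^ 2 := by
    rw [← hs2]; ring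
  rw [key]
  field_simp
  ring

/-- An isometry of the hyperbolic plane moves the midpoint of `x` and `γ x` by at most half the
distance from `x` to `γ (γ x)`. -/
theorem UpperHalfPlane.exists_two_mul_dist_map_le (γ : UpperHalfPlane ≃ᵢ UpperHalfPlane)
    (x : UpperHalfPlane) :
    ∃ m : UpperHalfPlane, 2 * dist m (γ m) ≤ dist x (γ (γ x)) := by
  obtain ⟨m, s, hs0, hs2, hm⟩ := exists_median x (γ x)
  refine ⟨m, ?_⟩
  have hD : dist (γ x) (γ (γ x)) = dist x (γ x) := γ.dist_eq _ _
  have h1 := hm (γ.symm m)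
  rw [← γ.dist_eq (γ.symm m) m, ← γ.dist_eq (γ.symm m) x, ← γ.dist_eq (γ.symm m) (γ x),
    γ.apply_symm_apply] at h1
  have h2 := hm (γ x)
  rw [dist_self, Real.cosh_zero, dist_comm (γ x) x, dist_comm (γ x) m] at h2
  have h3 := hm (γ (γ x))
  rw [dist_comm _ (γ x), hD, dist_comm _ x, dist_comm _ m] at h3
  have h4 : s ^ 2 * Real.cosh (dist m (γ m)) =
      2 * Real.cosh (dist x (γ x)) + 1 + Real.cosh (dist x (γ (γ x))) := by
    linear_combination s * h1 + h2 + h3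
  have hE : dist x (γ (γ x)) / 2 ≤ dist x (γ x) := by
    linarith [dist_triangle x (γ x) (γ (γ x))]
  have hC : Real.cosh (dist x (γ (γ x)) / 2) ≤ Real.cosh (dist x (γ x)) := by
    rw [Real.cosh_le_cosh, abs_of_nonneg (by positivity), abs_of_nonneg (by positivity)]
    exact hE
  have hC2 : Real.cosh (dist x (γ (γ x))) = 2 * Real.cosh (dist x (γ (γ x)) / 2) ^ 2 - 1 := by
    have h := Real.cosh_two_mul (dist x (γ (γ x)) / 2)
    rw [Real.sinh_sq, mul_div_cancel₀ _ two_ne_zero] at h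
    linarith
  have hC1 := Real.one_le_cosh (dist x (γ (γ x)) / 2)
  have h5 : Real.cosh (dist m (γ m)) ≤ Real.cosh (dist x (γ (γ x)) / 2) := by
    refine le_of_mul_le_mul_left ?_ (pow_pos hs0 2)
    rw [h4, hs2, hC2]
    nlinarith [mul_nonneg (sub_nonneg.2 hC) (sub_nonneg.2 hC1)]
  rw [Real.cosh_le_cosh, abs_of_nonneg (by positivity), abs_of_nonneg (by positivity)] at h5
  linarith

theorem UpperHalfPlane.two_pow_mul_le_dist_pow (γ : UpperHalfPlane ≃ᵢ UpperHalfPlane) {T : ℝ}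
    (hγ : ∀ x : UpperHalfPlane, T ≤ dist x (γ x)) (k : ℕ) (x : UpperHalfPlane) :
    2 ^ k * T ≤ dist x ((γ ^ 2 ^ k) x) := by
  induction k generalizing x with
  | zero => simpa using hγ x
  | succ k ih =>
    obtain ⟨m, hm⟩ := exists_two_mul_dist_map_le (γ ^ 2 ^ k) x
    have h : γ ^ 2 ^ (k + 1) = γ ^ 2 ^ k * γ ^ 2 ^ k := by rw [← pow_add, ← two_mul, ← pow_succ']
    rw [h, IsometryEquiv.mul_apply, pow_succ]
    linarith [ih m]

theorem IsometryEquiv.dist_pow_apply_le {X : Type*} [PseudoMetricSpace X] (γ : X ≃ᵢ X) (n : ℕ)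
    (x : X) : dist x ((γ ^ n) x) ≤ n * dist x (γ x) := by
  induction n with
  | zero => simp
  | succ n ih =>
    have h : dist ((γ ^ n) x) ((γ ^ (n + 1)) x) = dist x (γ x) := by
      rw [pow_succ, IsometryEquiv.mul_apply, IsometryEquiv.dist_eq]
    push_cast
    linarith [dist_triangle x ((γ ^ n) x) ((γ ^ (n + 1)) x)]

/-- If an isometry of the hyperbolic plane moves every point by at least `T`, then its `n`-th power
moves every point by at least `n * T`. -/
theorem UpperHalfPlane.mul_le_dist_pow (γ : UpperHalfPlane ≃ᵢ UpperHalfPlane) {T : ℝ}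
    (hγ : ∀ x : UpperHalfPlane, T ≤ dist x (γ x)) (n : ℕ) (x : UpperHalfPlane) :
    n * T ≤ dist x ((γ ^ n) x) := by
  rcases n.eq_zero_or_pos with rfl | hn
  · simp
  have hn' : (0 : ℝ) < n := by exact_mod_cast hn
  have bound (k : ℕ) :
      2 ^ k * (n * T - dist x ((γ ^ n) x)) ≤ n * (n * dist x (γ x)) := by
    have h0 := two_pow_mul_le_dist_pow γ hγ k x
    have hdiv : n * (2 ^ k / n) + 2 ^ k % n = 2 ^ k := Nat.div_add_mod _ _
    have hmod : ((2 ^ k % n : ℕ) : ℝ) ≤ n := by exact_mod_cast (Nat.mod_lt _ hn).le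
    have hdivR : (n : ℝ) * (2 ^ k / n : ℕ) ≤ 2 ^ k := by
      exact_mod_cast Nat.mul_div_le (2 ^ k) n
    have h1 : dist x ((γ ^ 2 ^ k) x) ≤
        (2 ^ k / n : ℕ) * dist x ((γ ^ n) x) + (2 ^ k % n : ℕ) * dist x (γ x) := by
      have ha := IsometryEquiv.dist_pow_apply_le (γ ^ n) (2 ^ k / n) x
      have hb := IsometryEquiv.dist_pow_apply_le γ (2 ^ k % n) x
      have hab : dist ((γ ^ (n * (2 ^ k / n))) x) ((γ ^ 2 ^ k) x) =
          dist x ((γ ^ (2 ^ k % n)) x) := by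
        have h : γ ^ 2 ^ k = γ ^ (n * (2 ^ k / n)) * γ ^ (2 ^ k % n) := by rw [← pow_add, hdiv]
        rw [h, IsometryEquiv.mul_apply, IsometryEquiv.dist_eq]
      rw [← pow_mul] at ha
      linarith [dist_triangle x ((γ ^ (n * (2 ^ k / n))) x) ((γ ^ 2 ^ k) x)]
    have h2 := mul_le_mul_of_nonneg_right hdivR (dist_nonneg (x := x) (y := (γ ^ n) x))
    have h3 := mul_le_mul_of_nonneg_right hmod (dist_nonneg (x := x) (y := γ x))
    have h4 := mul_le_mul_of_nonneg_left (h0.trans h1) hn'.le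
    have h5 := mul_le_mul_of_nonneg_left h3 hn'.le
    linarith
  by_contra! h
  obtain ⟨k, hk⟩ := pow_unbounded_of_one_lt
    (n * (n * dist x (γ x)) / (n * T - dist x ((γ ^ n) x))) one_lt_two
  rw [div_lt_iff₀ (sub_pos.2 h)] at hk
  linarith [bound k]

theorem Int.finite_and_ncard_le_of_sub_le {S : Set ℤ} {R : ℝ} (hR : 0 ≤ R)
    (hS : ∀ m ∈ S, ∀ n ∈ S, ((n - m : ℤ) : ℝ) ≤ R) : S.Finite ∧ (S.ncard : ℝ) ≤ 1 + R := by
  rcases S.eq_empty_or_nonempty with rfl | ⟨n₀, hn₀⟩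
  · simpa using by linarith
  have hS' : ∀ m ∈ S, ∀ n ∈ S, n - m ≤ ⌊R⌋ := fun m hm n hn => Int.le_floor.2 (hS m hm n hn)
  have hfin : S.Finite := (Set.finite_Icc (n₀ - ⌊R⌋) (n₀ + ⌊R⌋)).subset fun n hn =>
    ⟨by linarith [hS' n hn n₀ hn₀], by linarith [hS' n₀ hn₀ n hn]⟩
  obtain ⟨a, ha, hmin⟩ := Set.exists_min_image S id hfin ⟨n₀, hn₀⟩
  have hsub : S ⊆ (Finset.Icc a (a + ⌊R⌋) : Finset ℤ) := fun n hn => by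
    rw [Finset.coe_Icc]
    exact ⟨hmin n hn, by linarith [hS' a ha n hn]⟩
  have hcard := Set.ncard_le_ncard hsub (Finset.finite_toSet _)
  rw [Set.ncard_coe_finset, Int.card_Icc] at hcard
  have hfloor : 0 ≤ ⌊R⌋ := Int.floor_nonneg.2 hR
  have hZ : (S.ncard : ℤ) ≤ 1 + ⌊R⌋ := by omega
  have hcast : (S.ncard : ℝ) ≤ 1 + (⌊R⌋ : ℝ) := by exact_mod_cast hZ
  exact ⟨hfin, hcast.trans (by linarith [Int.floor_le R])⟩

/-- If `γ` is an isometry of the hyperbolic plane with `dist(x, γ x) ≥ T > 0`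
for all `x`, then for any `p q` and `ℓ ≥ 0`, the set of integers `n` with
`dist(p, γⁿ q) ≤ ℓ` has at most `2 + 2ℓ/T` elements. -/
theorem stmt_2 (γ : UpperHalfPlane ≃ᵢ UpperHalfPlane) (T : ℝ) (hT : 0 < T)
    (hγ : ∀ x : UpperHalfPlane, T ≤ dist x (γ x))
    (p q : UpperHalfPlane) (ℓ : ℝ) (hℓ : 0 ≤ ℓ) :
    {n : ℤ | dist p ((γ ^ n) q) ≤ ℓ}.Finite ∧
      ({n : ℤ | dist p ((γ ^ n) q) ≤ ℓ}.ncard : ℝ) ≤ 2 + 2 * ℓ / T := by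
  have hR : 0 ≤ 2 * ℓ / T := by positivity
  obtain ⟨hfin, hcard⟩ := Int.finite_and_ncard_le_of_sub_le
    (S := {n : ℤ | dist p ((γ ^ n) q) ≤ ℓ}) hR fun m hm n hn => by
      rcases le_total n m with hnm | hmn
      · exact le_trans (by exact_mod_cast sub_nonpos.2 hnm) hR
      obtain ⟨k, rfl⟩ := Int.le.dest hmn
      have hk := mul_le_dist_pow γ hγ k q
      have heq : dist ((γ ^ m) q) ((γ ^ (m + (k : ℤ))) q) = dist q ((γ ^ k) q) := by
        rw [zpow_add, zpow_natCast, IsometryEquiv.mul_apply, IsometryEquiv.dist_eq]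
      rw [Set.mem_ofPred_eq] at hm hn
      rw [le_div_iff₀ hT, add_sub_cancel_left, Int.cast_natCast]
      linarith [dist_triangle_left ((γ ^ m) q) ((γ ^ (m + (k : ℤ))) q) p]
  exact ⟨hfin, by linarith⟩
end

section
/- Let M > 0 and let f : ℝ → ℝ be a bounded measurable function whose support is contained in [−M, M]. Then for every x > 0, Σ_{k=1}^∞ x·|f(kx)| / (2·sinh(kx/2)) ≤ (sup_{y∈ℝ} |f(y)|) · (max{0, log(M/x)} + 1). In particular |F_f(x)| is bounded by the right-hand side. -/
/-- If `f` is bounded measurable with support in `[−M, M]`, `M > 0`, then for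
`x > 0`, `Σ_{k≥1} x|f(kx)|/(2 sinh(kx/2)) ≤ ‖f‖_∞ (log⁺(M/x) + 1)`. -/
theorem stmt_7 (M : ℝ) (hM : 0 < M) (f : ℝ → ℝ) (hmeas : Measurable f)
    (hbdd : BddAbove (Set.range fun y => |f y|))
    (hsupp : Function.support f ⊆ Set.Icc (-M) M)
    (x : ℝ) (hx : 0 < x) :
    ∑' k : ℕ, x * |f (((k:ℝ) + 1) * x)| / (2 * Real.sinh (((k:ℝ) + 1) * x / 2))
      ≤ (⨆ y : ℝ, |f y|) * (max 0 (Real.log (M / x)) + 1) := by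
  have hC : 0 ≤ ⨆ y : ℝ, |f y| := Real.iSup_nonneg fun y => abs_nonneg (f y)
  have hzero : ∀ k ∉ Finset.range ⌊M / x⌋₊,
      x * |f (((k:ℝ) + 1) * x)| / (2 * Real.sinh (((k:ℝ) + 1) * x / 2)) = 0 := by
    intro k hk
    have hk' : ⌊M / x⌋₊ < k + 1 := by
      rw [Finset.mem_range] at hk
      omega
    have hlt : M < ((k:ℝ) + 1) * x := by
      rw [← div_lt_iff₀ hx]
      exact_mod_cast Nat.lt_of_floor_lt hk'
    have hf : f (((k:ℝ) + 1) * x) = 0 := by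
      by_contra h
      exact absurd (hsupp h).2 (not_le.mpr hlt)
    simp [hf]
  have hterm : ∀ k : ℕ, x * |f (((k:ℝ) + 1) * x)| / (2 * Real.sinh (((k:ℝ) + 1) * x / 2))
      ≤ (⨆ y : ℝ, |f y|) * ((k:ℝ) + 1)⁻¹ := by
    intro k
    have hk : (0:ℝ) < (k:ℝ) + 1 := by positivity
    have hsinh : ((k:ℝ) + 1) * x ≤ 2 * Real.sinh (((k:ℝ) + 1) * x / 2) := by
      have := Real.self_le_sinh_iff.mpr (by positivity : 0 ≤ ((k:ℝ) + 1) * x / 2)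
      linarith
    calc x * |f (((k:ℝ) + 1) * x)| / (2 * Real.sinh (((k:ℝ) + 1) * x / 2))
        ≤ x * (⨆ y : ℝ, |f y|) / (((k:ℝ) + 1) * x) := by
          have := le_ciSup hbdd (((k:ℝ) + 1) * x)
          gcongr
      _ = (⨆ y : ℝ, |f y|) * ((k:ℝ) + 1)⁻¹ := by field_simp
  have hharm : ∑ k ∈ Finset.range ⌊M / x⌋₊, ((k:ℝ) + 1)⁻¹ ≤ max 0 (Real.log (M / x)) + 1 := by
    rcases le_or_gt 1 (M / x) with h | h
    · have := harmonic_floor_le_one_add_log (M / x) h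
      simp only [harmonic, Rat.cast_sum, Rat.cast_inv, Rat.cast_natCast, Nat.cast_add,
        Nat.cast_one, Rat.cast_add, Rat.cast_one] at this
      linarith [le_max_right 0 (Real.log (M / x))]
    · rw [Nat.floor_eq_zero.mpr h]
      simp only [Finset.range_zero, Finset.sum_empty]
      positivity
  rw [tsum_eq_sum hzero]
  calc _ ≤ ∑ k ∈ Finset.range ⌊M / x⌋₊, (⨆ y : ℝ, |f y|) * ((k:ℝ) + 1)⁻¹ :=
        Finset.sum_le_sum fun k _ => hterm k
    _ = (⨆ y : ℝ, |f y|) * ∑ k ∈ Finset.range ⌊M / x⌋₊, ((k:ℝ) + 1)⁻¹ :=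
        (Finset.mul_sum _ _ _).symm
    _ ≤ _ := mul_le_mul_of_nonneg_left hharm hC
end

section
/- There exists a function f : ℝ → ℝ which is infinitely differentiable, even (f(−x) = f(x) for all x), nonnegative, supported in [−1, 1], and satisfies: (i) ∫_ℝ f(x)·cos(rx) dx ≥ 0 for every real r, and (ii) ∫_ℝ f(x)·cosh(tx) dx > 0 for every real t. -/
open MeasureTheory

open scoped Convolution

open ContinuousLinearMap in
/-- The cosine transform of the convolution square of an even, continuous, compactly supported
function is the square of its cosine transform. -/
theorem integral_convolution_self_mul_cos {g : ℝ → ℝ} (hg : Continuous g)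
    (hc : HasCompactSupport g) (he : ∀ x, g (-x) = g x) (r : ℝ) :
    ∫ x, (g ⋆[mul ℝ ℝ, volume] g) x * Real.cos (r * x) =
      (∫ x, g x * Real.cos (r * x)) ^ 2 := by
  set C : ℝ → ℝ := fun x => g x * Real.cos (r * x) with hC
  set S : ℝ → ℝ := fun x => g x * Real.sin (r * x) with hS
  have hCc : Continuous C := by fun_prop
  have hSc : Continuous S := by fun_prop
  have hCs : HasCompactSupport C := hc.mul_right
  have hSs : HasCompactSupport S := hc.mul_right
  have hCi : Integrable C := hCc.integrable_of_hasCompactSupport hCs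
  have hSi : Integrable S := hSc.integrable_of_hasCompactSupport hSs
  have hS0 : ∫ x, S x = 0 := by
    have h : ∫ x, S (-x) = ∫ x, S x := integral_neg_eq_self S volume
    have h' : ∀ x, S (-x) = -S x := fun x => by simp [hS, he]
    simp only [h', integral_neg] at h
    linarith
  have key : ∀ x, (g ⋆[mul ℝ ℝ, volume] g) x * Real.cos (r * x) =
      (C ⋆[mul ℝ ℝ, volume] C) x - (S ⋆[mul ℝ ℝ, volume] S) x := by
    intro x
    have iC := (hCs.convolutionExists_left (mul ℝ ℝ) hCc
      hCc.locallyIntegrable x : ConvolutionExistsAt C C x _ volume).integrable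
    have iS := (hSs.convolutionExists_left (mul ℝ ℝ) hSc
      hSc.locallyIntegrable x : ConvolutionExistsAt S S x _ volume).integrable
    rw [convolution_def, convolution_def, convolution_def, ← integral_sub iC iS,
      ← integral_mul_const]
    refine integral_congr_ae (.of_forall fun t => ?_)
    have hx : r * x = r * t + r * (x - t) := by ring
    simp only [mul_apply', hC, hS]
    rw [hx, Real.cos_add]
    ring
  simp_rw [key]
  rw [integral_sub (hCi.integrable_convolution _ hCi) (hSi.integrable_convolution _ hSi),
    integral_convolution _ hCi hCi, integral_convolution _ hSi hSi, hS0]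
  simp [sq]

/-- There exists a smooth, even, nonnegative function supported in `[−1,1]`
whose Fourier transform is nonnegative on `ℝ` and positive on `iℝ`. -/
theorem stmt_12 :
    ∃ f : ℝ → ℝ, ContDiff ℝ (⊤ : ℕ∞) f ∧ (∀ x, f (-x) = f x) ∧ (∀ x, 0 ≤ f x) ∧
      Function.support f ⊆ Set.Icc (-1) 1 ∧
      (∀ r : ℝ, 0 ≤ ∫ x : ℝ, f x * Real.cos (r * x)) ∧
      (∀ t : ℝ, 0 < ∫ x : ℝ, f x * Real.cosh (t * x)) := by
  let g : ContDiffBump (0 : ℝ) := ⟨1 / 4, 1 / 2, by norm_num, by norm_num⟩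
  have hg : Continuous g := g.continuous
  have hc : HasCompactSupport g := g.hasCompactSupport
  have hg0 : g 0 ≠ 0 := (g.pos_of_mem_ball (Metric.mem_ball_self g.rOut_pos)).ne'
  set f : ℝ → ℝ := g ⋆[ContinuousLinearMap.mul ℝ ℝ, volume] g with hf
  have hsmooth : ContDiff ℝ (⊤ : ℕ∞) f :=
    hc.contDiff_convolution_right _ hg.locallyIntegrable g.contDiff
  have hnonneg : ∀ x, 0 ≤ f x := fun x =>
    integral_nonneg fun t => mul_nonneg g.nonneg g.nonneg
  have hf0 : 0 < f 0 := by
    have h : f 0 = ∫ t, g t * g t := by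
      simp [hf, convolution_def, g.neg]
    rw [h]
    exact (hg.mul hg).integral_pos_of_hasCompactSupport_nonneg_nonzero hc.mul_right
      (fun t => mul_self_nonneg _) (mul_ne_zero hg0 hg0)
  refine ⟨f, hsmooth, fun x => ?_, hnonneg, ?_, fun r => ?_, fun t => ?_⟩
  · exact convolution_neg_of_neg_eq _ (.of_forall g.neg) (.of_forall g.neg)
  · refine (support_convolution_subset _).trans ?_
    rintro _ ⟨a, ha, b, hb, rfl⟩
    rw [g.support_eq, Real.ball_eq_Ioo] at ha hb
    simp only [g, Set.mem_Ioo] at ha hb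
    constructor <;> simp only <;> linarith [ha.1, ha.2, hb.1, hb.2]
  · rw [integral_convolution_self_mul_cos hg hc (fun x => g.neg x)]
    positivity
  · have hfc : HasCompactSupport f := hc.convolution _ hc
    have hcont : Continuous fun x => f x * Real.cosh (t * x) :=
      hsmooth.continuous.mul (Real.continuous_cosh.comp (continuous_const.mul continuous_id))
    refine hcont.integral_pos_of_hasCompactSupport_nonneg_nonzero (x := 0) hfc.mul_right
      (fun x => mul_nonneg (hnonneg x) (Real.cosh_pos _).le) ?_
    simpa using hf0.ne'
end
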